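/- Let (𝓘, ⊆) be a locally finite poset. Assume that for every I ∈ 𝓘 there is a finite set I⁺ ⊆ 𝓘 such that {J ∈ 𝓘 : J ⊋ I} = {J ∈ 𝓘 : ∃K ∈ I⁺ with J ⊇ K}, and that every subset of I⁺ has a join (least upper bound) in 𝓘. Then the Möbius function of 𝓘 is given explicitly by: μ(J, I) = 1 if J = I, and μ(J, I) = Σ_{x ⊆ I⁺ with ∨x = J} (−1)^{|x|} if J ⊋ I. -/

import Mathlib

open Finset
open scoped Classical

/-- Summing `(-1) ^ #x` over the nonempty `x ⊆ A`, grouped by their least upper bounds in `Ioc I J`,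
gives `-1` as soon as `A` generates the elements strictly above `I`. -/
lemma sum_Ioc_sum_isLUB_neg_one_pow_card {α : Type*} [PartialOrder α] [LocallyFiniteOrder α]
    {A : Finset α} {I J : α} (hcover : ∀ K, I < K ↔ ∃ a ∈ A, a ≤ K)
    (hjoin : ∀ x ⊆ A, x.Nonempty → ∃ j, IsLUB (x : Set α) j) (hIJ : I < J) :
    ∑ K ∈ Ioc I J, ∑ x ∈ A.powerset.filter (fun x : Finset α => IsLUB (x : Set α) K),
      (-1 : ℤ) ^ x.card = -1 := by
  have hS : (A.filter (· ≤ J)).Nonempty := by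
    obtain ⟨a, ha, haJ⟩ := (hcover J).1 hIJ
    exact ⟨a, mem_filter.2 ⟨ha, haJ⟩⟩
  have hzero := sum_powerset_neg_one_pow_card_of_nonempty hS
  rw [← add_sum_erase _ _ (empty_mem_powerset _)] at hzero
  rw [sum_comm' (t' := (A.filter (· ≤ J)).powerset.erase ∅)
    (s' := fun x => (Ioc I J).filter (fun K => IsLUB (x : Set α) K))]
  · suffices h : ∀ x ∈ (A.filter (· ≤ J)).powerset.erase ∅,
        ∑ _K ∈ (Ioc I J).filter (fun K => IsLUB (x : Set α) K), (-1 : ℤ) ^ x.card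
          = (-1) ^ x.card by
      rw [sum_congr rfl h]
      simp only [card_empty, pow_zero] at hzero
      linarith
    intro x hx
    obtain ⟨hne, hxS⟩ := mem_erase.1 hx
    rw [mem_powerset] at hxS
    have hx0 := nonempty_iff_ne_empty.2 hne
    obtain ⟨j, hj⟩ := hjoin x (hxS.trans (filter_subset _ _)) hx0
    have hjJ : j ≤ J := hj.2 fun a ha => (mem_filter.1 (hxS ha)).2
    have hIj : I < j := by
      obtain ⟨a, ha⟩ := hx0
      exact (hcover j).2 ⟨a, (mem_filter.1 (hxS ha)).1, hj.1 ha⟩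
    have hsingle : (Ioc I J).filter (fun K => IsLUB (x : Set α) K) = {j} := by
      ext K
      simp only [mem_filter, mem_Ioc, mem_singleton]
      refine ⟨fun h => h.2.unique hj, ?_⟩
      rintro rfl
      exact ⟨⟨hIj, hjJ⟩, hj⟩
    rw [hsingle, sum_singleton]
  · intro K x
    simp only [mem_filter, mem_Ioc, mem_powerset, mem_erase]
    constructor
    · rintro ⟨⟨hIK, hKJ⟩, hxA, hK⟩
      refine ⟨⟨⟨hIK, hKJ⟩, hK⟩, ?_, fun a ha => mem_filter.2 ⟨hxA ha, (hK.1 ha).trans hKJ⟩⟩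
      rintro rfl
      exact hIK.not_ge (hK.2 (by simp))
    · rintro ⟨⟨hK, hlub⟩, -, hxS⟩
      exact ⟨hK, hxS.trans (filter_subset _ _), hlub⟩

/-- Proposition `prop explicit mobius inverse`: let `(𝓘, ⊆)` be a
locally finite poset such that every `I` admits a finite set `I⁺` with
`{J : J ⊋ I} = {J : ∃ K ∈ I⁺, J ⊇ K}`, every nonempty subset of which has a join.
Then the Möbius function of `𝓘` is given by `μ(J, I) = 1` if `J = I` and
`μ(J, I) = Σ_{x ⊆ I⁺, ∨x = J} (−1)^{|x|}` if `J ⊋ I`. (Here the poset `𝓘` is an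
abstract locally finite partial order `α`, `μ(J, I)` is `IncidenceAlgebra.mu ℤ I J`,
and `∨x = J` is expressed by `IsLUB ↑x J`.) -/
theorem mobius_explicit
    {α : Type} [PartialOrder α] [LocallyFiniteOrder α] [DecidableEq α]
    (Iplus : α → Finset α)
    (hcover : ∀ I : α, {J : α | I < J} = {J : α | ∃ K ∈ Iplus I, K ≤ J})
    (hjoin : ∀ I : α, ∀ x ⊆ Iplus I, x.Nonempty → ∃ j : α, IsLUB (↑x : Set α) j) :
    ∀ I J : α, I ≤ J →
      IncidenceAlgebra.mu ℤ I J =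
        if J = I then 1
        else ∑ x ∈ (Iplus I).powerset.filter (fun x : Finset α => IsLUB (↑x : Set α) J),
          (-1 : ℤ) ^ x.card := by
  intro I
  set f : α → ℤ := fun J => ∑ x ∈ (Iplus I).powerset.filter
    (fun x : Finset α => IsLUB (↑x : Set α) J), (-1 : ℤ) ^ x.card
  suffices h : ∀ n : ℕ, ∀ J, (Icc I J).card = n → I < J → IncidenceAlgebra.mu ℤ I J = f J by
    intro J hIJ
    split_ifs with hJ
    · rw [hJ, IncidenceAlgebra.mu_self]
    · exact h _ J rfl (lt_of_le_of_ne hIJ (Ne.symm hJ))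
  intro n
  induction n using Nat.strong_induction_on with
  | _ n ih =>
    rintro J rfl hIJ
    have hsum : ∑ K ∈ Ioc I J, f K = -1 :=
      sum_Ioc_sum_isLUB_neg_one_pow_card (fun K => Set.ext_iff.1 (hcover I) K) (hjoin I) hIJ
    have hIoo : ∑ K ∈ Ioo I J, IncidenceAlgebra.mu ℤ I K = ∑ K ∈ Ioo I J, f K := by
      refine sum_congr rfl fun K hK => ?_
      obtain ⟨hIK, hKJ⟩ := mem_Ioo.1 hK
      exact ih _ (card_lt_card (Icc_ssubset_Icc_right hIJ.le le_rfl hKJ)) K rfl hIK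
    rw [← Ioo_insert_right hIJ, sum_insert right_notMem_Ioo] at hsum
    rw [IncidenceAlgebra.mu_eq_neg_sum_Ico_of_ne hIJ.ne, ← Ioo_insert_left hIJ,
      sum_insert left_notMem_Ioo, IncidenceAlgebra.mu_self, hIoo]
    linarith
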